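/- arXiv:1504.06240 — 3 statements merged into one kernel-verified Lean document; each statement's English description precedes it below -/
import Mathlib

section
/- Computability of m: for every nonempty binary string s, the real number m(s) is a computable real; in particular, for every k ≥ 1 one has 0 ≤ m(s) − m_k(s) ≤ 1/2^k, so the computable rationals m_k(s) provide effective approximations to m(s) with error bound 2^(−k). -/
/-- An instruction of a Busy Beaver machine: `Sum.inl b` means "write `b` and move to the
halting state (no head movement)"; `Sum.inr (q, b, d)` means "write `b`, move the head in
direction `d` (`true` = right, `false` = left) and change to state `q`".  For the class
`(n,2)` there are `4 * n + 2` instructions. -/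
abbrev Instr (n : ℕ) := Bool ⊕ (Fin n × Bool × Bool)

/-- A Turing machine in the class `(n,2)`: a transition table assigning an instruction to
every pair (current state, read symbol). -/
abbrev Machine (n : ℕ) := (Fin n × Bool) → Instr n

/-- A configuration: current state (`none` = halted), tape contents, head position, and the
interval `[lo, hi]` of cells visited so far by the head. -/
structure Config (n : ℕ) where
  state : Option (Fin n)
  tape : ℤ → Bool
  pos : ℤ
  lo : ℤ
  hi : ℤ

/-- One computation step. -/
def step {n : ℕ} (M : Machine n) (c : Config n) : Config n :=
  match c.state with
  | none => c
  | some q =>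
    match M (q, c.tape c.pos) with
    | Sum.inl b => { c with state := none, tape := Function.update c.tape c.pos b }
    | Sum.inr (q', b, d) =>
      let p := c.pos + (if d then 1 else -1)
      { state := some q', tape := Function.update c.tape c.pos b,
        pos := p, lo := min c.lo p, hi := max c.hi p }

/-- The initial configuration on a tape uniformly filled with the blank symbol `i`,
started in the initial state (state `⟨0, _⟩`, i.e. state "1" of `{1,…,n}`). -/
def initConfig (n : ℕ) (i : Bool) : Config n :=
  { state := if h : 0 < n then some ⟨0, h⟩ else none,
    tape := fun _ => i, pos := 0, lo := 0, hi := 0 }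

/-- The configuration after `t` steps of the run `τ(i)`. -/
def cfgAt {n : ℕ} (M : Machine n) (i : Bool) (t : ℕ) : Config n :=
  (step M)^[t] (initConfig n i)

/-- A configuration is halted when the machine has entered the halting state. -/
def Halted {n : ℕ} (c : Config n) : Prop := c.state = none

/-- The output read off a configuration: the symbols in the cells visited by the head. -/
def outputOf {n : ℕ} (c : Config n) : List Bool :=
  (List.range (c.hi - c.lo + 1).toNat).map fun j => c.tape (c.lo + j)

/-- `Outputs M i s` : the run `τ(i)` of `M` on blank symbol `i` halts with output `s`. -/
def Outputs {n : ℕ} (M : Machine n) (i : Bool) (s : List Bool) : Prop :=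
  ∃ t, Halted (cfgAt M i t) ∧ outputOf (cfgAt M i t) = s

/-- `|{τ ∈ (n,2) : τ(i) = s}|`. -/
noncomputable def numOutput (n : ℕ) (i : Bool) (s : List Bool) : ℕ :=
  Nat.card {τ : Machine n // Outputs τ i s}

/-- The exponent `n + 1 + ⌈log₂((4n+2)^(2n))⌉` (the length of the program encodings
with `n` states). -/
def expo (n : ℕ) : ℕ := n + 1 + Nat.clog 2 ((4 * n + 2) ^ (2 * n))

/-- The `n`-th term of the series defining `m(s)`. -/
noncomputable def mTerm (n : ℕ) (s : List Bool) : ℝ :=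
  ((numOutput n false s + numOutput n true s : ℕ) : ℝ) / 2 ^ expo n

/-- The measure `m(s) = Σ_{n=1}^∞ (|{τ ∈ (n,2) : τ(0)=s}| + |{τ ∈ (n,2) : τ(1)=s}|) /
2^(n+1+⌈log₂((4n+2)^(2n))⌉)`. -/
noncomputable def mDist (s : List Bool) : ℝ := ∑' j : ℕ, mTerm (j + 1) s

/-- The finite approximation `m_k(s)`: the same sum truncated to `1 ≤ n ≤ k`. -/
noncomputable def mApprox (k : ℕ) (s : List Bool) : ℝ :=
  ∑ n ∈ Finset.Icc 1 k, mTerm n s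

/-- The finite approximation `m_k(s)` as a rational number. -/
noncomputable def mApproxQ (k : ℕ) (s : List Bool) : ℚ :=
  ∑ n ∈ Finset.Icc 1 k,
    ((numOutput n false s + numOutput n true s : ℕ) : ℚ) / 2 ^ expo n


theorem mTerm_nonneg (n : ℕ) (s : List Bool) : 0 ≤ mTerm n s := by
  unfold mTerm; positivity

theorem numOutput_le (n : ℕ) (i : Bool) (s : List Bool) :
    numOutput n i s ≤ (4 * n + 2) ^ (2 * n) := by
  refine (Nat.card_le_card_of_injective _ Subtype.val_injective).trans ?_
  have h₁ : 2 + n * (2 * 2) = 4 * n + 2 := by ring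
  simp [h₁, mul_comm n 2]

theorem mTerm_le (n : ℕ) (s : List Bool) : mTerm n s ≤ 1 / 2 ^ n := by
  unfold mTerm
  rw [div_le_div_iff₀ (by positivity) (by positivity)]
  have h₁ := numOutput_le n false s
  have h₂ := numOutput_le n true s
  have h₃ := Nat.le_pow_clog (b := 2) one_lt_two ((4 * n + 2) ^ (2 * n))
  have h : (numOutput n false s + numOutput n true s) * 2 ^ n ≤ 1 * 2 ^ expo n := by
    calc (numOutput n false s + numOutput n true s) * 2 ^ n
        ≤ (2 * 2 ^ Nat.clog 2 ((4 * n + 2) ^ (2 * n))) * 2 ^ n :=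
          Nat.mul_le_mul_right _ (by omega)
      _ = 1 * 2 ^ expo n := by unfold expo; ring
  exact_mod_cast h

theorem hasSum_geometric_tail (k : ℕ) :
    HasSum (fun j : ℕ => (1 : ℝ) / 2 ^ (j + k + 1)) (1 / 2 ^ k) := by
  convert hasSum_geometric_two' ((1 : ℝ) / 2 ^ k) using 2 with j
  field_simp
  ring

theorem summable_mTerm (s : List Bool) : Summable fun j : ℕ => mTerm (j + 1) s :=
  Summable.of_nonneg_of_le (fun _ => mTerm_nonneg _ _) (fun _ => mTerm_le _ _)
    (hasSum_geometric_tail 0).summable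

theorem mDist_sub_mApprox (k : ℕ) (s : List Bool) :
    mDist s - mApprox k s = ∑' j : ℕ, mTerm (j + k + 1) s := by
  rw [sub_eq_iff_eq_add', mDist, ← (summable_mTerm s).sum_add_tsum_nat_add k, mApprox,
    Finset.range_eq_Ico, Finset.sum_Ico_add' (fun n => mTerm n s) 0 k 1]
  rfl

theorem mDist_sub_mApprox_mem (k : ℕ) (s : List Bool) :
    0 ≤ mDist s - mApprox k s ∧ mDist s - mApprox k s ≤ 1 / 2 ^ k := by
  rw [mDist_sub_mApprox]
  refine ⟨tsum_nonneg fun _ => mTerm_nonneg _ _, ?_⟩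
  rw [← (hasSum_geometric_tail k).tsum_eq]
  exact ((summable_nat_add_iff k).2 (summable_mTerm s)).tsum_le_tsum (fun _ => mTerm_le _ _)
    (hasSum_geometric_tail k).summable

theorem mApproxQ_cast (k : ℕ) (s : List Bool) : (mApproxQ k s : ℝ) = mApprox k s := by
  simp [mApproxQ, mApprox, mTerm]

namespace Primrec

theorem nat_pow : Primrec₂ ((· ^ ·) : ℕ → ℕ → ℕ) :=
  Primrec₂.unpaired'.1 Nat.Primrec.pow

theorem nat_clog_two : Primrec (Nat.clog 2) := by
  refine of_graph ⟨_, Primrec.id, fun n => ?_⟩ ?_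
  · exact Nat.clog_le_of_le_pow (Nat.lt_two_pow_self).le
  · have h : PrimrecRel fun n y : ℕ => n ≤ 2 ^ y ∧ (y = 0 ∨ 2 ^ (y - 1) < n) :=
      .and (nat_le.comp fst (nat_pow.comp (const 2) snd))
        (.or (Primrec.eq.comp snd (const 0))
          (nat_lt.comp (nat_pow.comp (const 2) (nat_sub.comp snd (const 1))) fst))
    refine h.of_eq fun n y => ?_
    rw [le_antisymm_iff (a := Nat.clog 2 n), Nat.clog_le_iff_le_pow one_lt_two]
    refine and_congr_right fun _ => ?_
    cases y with
    | zero => simp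
    | succ y => simp [Nat.lt_clog_iff_pow_lt one_lt_two]

theorem nat_gcd : Primrec₂ Nat.gcd := by
  have h : PrimrecRel fun (p : ℕ × ℕ) d => p.1 % d = 0 ∧ p.2 % d = 0 :=
    .and (Primrec.eq.comp (nat_mod.comp (fst.comp fst) snd) (const 0))
      (Primrec.eq.comp (nat_mod.comp (snd.comp fst) snd) (const 0))
  refine (nat_findGreatest (nat_add.comp fst snd) h).of_eq fun p => ?_
  rw [Nat.findGreatest_eq_iff]
  refine ⟨?_, fun _ => ⟨?_, ?_⟩, fun d hd _ hdvd => ?_⟩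
  · rcases Nat.eq_zero_or_pos p.1 with h | h
    · simp [h]
    · exact (Nat.gcd_le_left _ h).trans (Nat.le_add_right _ _)
  · exact Nat.mod_eq_zero_of_dvd (Nat.gcd_dvd_left _ _)
  · exact Nat.mod_eq_zero_of_dvd (Nat.gcd_dvd_right _ _)
  · have h₁ := Nat.dvd_gcd (Nat.dvd_of_mod_eq_zero hdvd.1) (Nat.dvd_of_mod_eq_zero hdvd.2)
    rcases Nat.eq_zero_or_pos (p.1.gcd p.2) with h | h
    · have := Nat.gcd_eq_zero_iff.1 h; omega
    · exact hd.not_ge (Nat.le_of_dvd h h₁)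

theorem expo : Primrec expo :=
  nat_add.comp (nat_add.comp .id (const 1)) <| nat_clog_two.comp <| nat_pow.comp
    (nat_add.comp (nat_mul.comp (const 4) .id) (const 2)) (nat_mul.comp (const 2) .id)

end Primrec

/-- The codes of reduced fractions under the encoding `Rat.instEncodable`. -/
def IsRatCode (m : ℕ) : Prop :=
  0 < m.unpair.2 ∧ ((m.unpair.1 + 1) / 2).gcd m.unpair.2 = 1

instance : DecidablePred IsRatCode := fun _ => inferInstanceAs (Decidable (_ ∧ _))

theorem primrecPred_isRatCode : PrimrecPred IsRatCode := by
  have h₁ := Primrec.fst.comp Primrec.unpair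
  have h₂ := Primrec.snd.comp Primrec.unpair
  exact .and (Primrec.nat_lt.comp (.const 0) h₂) <| Primrec.eq.comp
    (Primrec.nat_gcd.comp (Primrec.nat_div.comp (Primrec.succ.comp h₁) (.const 2)) h₂) (.const 1)

theorem encode_rat_eq (q : ℚ) :
    @Encodable.encode ℚ Rat.instEncodable q = Nat.pair (Encodable.encode q.num) q.den := rfl

theorem natAbs_eq_encode (z : ℤ) : (Encodable.encode z + 1) / 2 = z.natAbs := by
  cases z with
  | ofNat k => change (2 * k + 1) / 2 = k; omega
  | negSucc k => change (2 * k + 1 + 1) / 2 = k + 1; omega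

theorem mem_range_encode_rat_iff (m : ℕ) :
    m ∈ Set.range (@Encodable.encode ℚ Rat.instEncodable) ↔ IsRatCode m := by
  constructor
  · rintro ⟨q, rfl⟩
    rw [encode_rat_eq]
    simpa [IsRatCode, natAbs_eq_encode] using ⟨q.pos, q.reduced⟩
  · rintro ⟨h₁, h₂⟩
    obtain ⟨z, hz⟩ : ∃ z : ℤ, Encodable.encode z = m.unpair.1 :=
      ⟨Denumerable.ofNat ℤ _, Denumerable.encode_ofNat _⟩
    rw [← hz, natAbs_eq_encode] at h₂
    refine ⟨⟨z, m.unpair.2, h₁.ne', h₂⟩, ?_⟩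
    rw [encode_rat_eq, hz, Nat.pair_unpair]

theorem encode_rat_denumerable (q : ℚ) :
    @Encodable.encode ℚ (Primcodable.ofDenumerable ℚ).toEncodable q =
      ((List.range (Nat.pair (Encodable.encode q.num) q.den)).filter IsRatCode).length := by
  rw [← List.countP_eq_length_filter]
  change List.countP (fun m => @decide (m ∈ Set.range (@Encodable.encode ℚ Rat.instEncodable))
    (Encodable.decidableRangeEncode ℚ m)) (List.range (@Encodable.encode ℚ Rat.instEncodable q)) = _
  rw [encode_rat_eq]
  refine List.countP_congr fun m _ => ?_
  simp only [decide_eq_true_eq]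
  exact mem_range_encode_rat_iff m

theorem Primrec.rat_div {α : Type*} [Primcodable α] {a d : α → ℕ} (ha : Primrec a)
    (hd : Primrec d) (hpos : ∀ x, 0 < d x) : Primrec fun x => (a x : ℚ) / (d x : ℚ) := by
  have hg := nat_gcd.comp ha hd
  refine Primrec.encode_iff.1 <| (list_length.comp <| (listFilter primrecPred_isRatCode).comp <|
    list_range.comp <| Primrec₂.natPair.comp
      (nat_mul.comp (const 2) (nat_div.comp ha hg)) (nat_div.comp hd hg)).of_eq fun x => ?_
  have hgpos := Nat.gcd_pos_of_pos_right (a x) (hpos x)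
  have hdpos := Nat.div_pos (Nat.gcd_le_right (a x) (hpos x)) hgpos
  have hcop := Nat.coprime_div_gcd_div_gcd hgpos
  have hq : (a x : ℚ) / (d x : ℚ) =
      (((a x / (a x).gcd (d x) : ℕ) : ℤ) : ℚ) / (((d x / (a x).gcd (d x) : ℕ) : ℤ) : ℚ) := by
    have hne : ((a x).gcd (d x) : ℚ) ≠ 0 := by exact_mod_cast hgpos.ne'
    rw [Int.cast_natCast, Int.cast_natCast, Nat.cast_div (Nat.gcd_dvd_left _ _) hne,
      Nat.cast_div (Nat.gcd_dvd_right _ _) hne, div_div_div_cancel_right₀ hne]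
  have hnum := Rat.num_div_eq_of_coprime
    (a := ((a x / (a x).gcd (d x) : ℕ) : ℤ)) (Int.natCast_pos.2 hdpos) hcop
  have hden := Rat.den_div_eq_of_coprime
    (a := ((a x / (a x).gcd (d x) : ℕ) : ℤ)) (Int.natCast_pos.2 hdpos) hcop
  rw [← hq] at hnum hden
  refine Eq.trans ?_ (encode_rat_denumerable _).symm
  rw [hnum, Int.natCast_inj.1 hden]
  rfl

/-- The configuration of a machine restricted to the visited cells: the state (`0` is the halting
state and `q + 1` the state `q`), the visited cells to the left of the head (nearest first), the
scanned symbol, and the visited cells to the right of the head. -/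
abbrev ZipConfig := ℕ × List Bool × Bool × List Bool

/-- Execute the instruction with code `c` on a `ZipConfig`, the blank symbol being `i`. -/
def zipApply (i : Bool) (c : ℕ) (Z : ZipConfig) : ZipConfig :=
  if c < 2 then (0, Z.2.1, decide (c = 1), Z.2.2.2)
  else if (c - 2) % 2 = 1 then
    ((c - 2) / 4 + 1, decide ((c - 2) / 2 % 2 = 1) :: Z.2.1, Z.2.2.2.headD i, Z.2.2.2.tail)
  else
    ((c - 2) / 4 + 1, Z.2.1.tail, Z.2.1.headD i, decide ((c - 2) / 2 % 2 = 1) :: Z.2.2.2)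

/-- One step of the `n`-state machine with code `m`. -/
def zipStep (n m : ℕ) (i : Bool) (Z : ZipConfig) : ZipConfig :=
  if Z.1 = 0 then Z
  else zipApply i (m / (2 + n * 4) ^ (Z.2.2.1.toNat + 2 * (Z.1 - 1)) % (2 + n * 4)) Z

/-- The initial `ZipConfig` on the blank symbol `i`. -/
def zipInit (i : Bool) : ZipConfig := (1, [], i, [])

/-- The visited cells, from left to right. -/
def zipOutput (Z : ZipConfig) : List Bool := Z.2.1.reverse ++ Z.2.2.1 :: Z.2.2.2

/-- The code of an instruction. -/
def instrEquiv (n : ℕ) : Instr n ≃ Fin (2 + n * 4) :=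
  (Equiv.sumCongr finTwoEquiv.symm (((Equiv.refl (Fin n)).prodCongr
    ((finTwoEquiv.symm.prodCongr finTwoEquiv.symm).trans finProdFinEquiv)).trans
      finProdFinEquiv)).trans finSumFinEquiv

/-- The code of a machine. -/
def machineEquiv (n : ℕ) : Machine n ≃ Fin ((2 + n * 4) ^ (n * 2)) :=
  (Equiv.arrowCongr (((Equiv.refl (Fin n)).prodCongr finTwoEquiv.symm).trans finProdFinEquiv)
    (instrEquiv n)).trans finFunctionFinEquiv

theorem val_finTwoEquiv_symm (b : Bool) : (finTwoEquiv.symm b : ℕ) = b.toNat := by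
  cases b <;> rfl

theorem instrEquiv_inl (n : ℕ) (b : Bool) : (instrEquiv n (.inl b) : ℕ) = b.toNat := by
  simp [instrEquiv, val_finTwoEquiv_symm]

theorem instrEquiv_inr (n : ℕ) (q : Fin n) (b d : Bool) :
    (instrEquiv n (.inr (q, b, d)) : ℕ) = 2 + (d.toNat + 2 * b.toNat + 4 * q) := by
  simp only [instrEquiv, Equiv.trans_apply, Equiv.sumCongr_apply, Sum.map_inr]
  cases b <;> cases d <;> rfl

theorem machineEquiv_div_mod {n : ℕ} (M : Machine n) (q : Fin n) (a : Bool) :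
    (machineEquiv n M : ℕ) / (2 + n * 4) ^ (a.toNat + 2 * (q : ℕ)) % (2 + n * 4) =
      instrEquiv n (M (q, a)) := by
  have h : finFunctionFinEquiv.symm (machineEquiv n M) (finProdFinEquiv (q, finTwoEquiv.symm a)) =
      instrEquiv n (M (q, a)) := by
    simp [machineEquiv]
  rw [← h, finFunctionFinEquiv_symm_apply_val]
  simp [val_finTwoEquiv_symm]

/-- The `ZipConfig` `Z` describes the configuration `c` on the blank symbol `i`. -/
structure Describes {n : ℕ} (i : Bool) (c : Config n) (Z : ZipConfig) : Prop where
  state : Z.1 = c.state.elim 0 (fun q => (q : ℕ) + 1)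
  lo : c.lo = c.pos - Z.2.1.length
  hi : c.hi = c.pos + Z.2.2.2.length
  scanned : c.tape c.pos = Z.2.2.1
  left : ∀ k : ℕ, c.tape (c.pos - 1 - k) = Z.2.1.getD k i
  right : ∀ k : ℕ, c.tape (c.pos + 1 + k) = Z.2.2.2.getD k i

theorem describes_init {n : ℕ} (hn : 0 < n) (i : Bool) :
    Describes i (initConfig n i) (zipInit i) := by
  constructor <;> simp [initConfig, zipInit, hn]

theorem Describes.step {n : ℕ} {i : Bool} {c : Config n} {Z : ZipConfig} (M : Machine n)
    (h : Describes i c Z) :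
    Describes i (_root_.step M c) (zipStep n (machineEquiv n M) i Z) := by
  obtain ⟨state, tape, pos, lo, hi⟩ := c
  obtain ⟨z, l, a, r⟩ := Z
  obtain ⟨h₁, h₂, h₃, h₄, h₅, h₆⟩ := h
  dsimp only at *
  subst h₁ h₂ h₃ h₄
  cases state with
  | none => exact ⟨rfl, rfl, rfl, rfl, h₅, h₆⟩
  | some q =>
    simp only [_root_.step, zipStep, Option.elim, Nat.add_sub_cancel, Nat.succ_ne_zero, if_false,
      machineEquiv_div_mod]
    rcases hM : M (q, tape pos) with b | ⟨q', b, d⟩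
    · rw [instrEquiv_inl]
      have hb : b.toNat < 2 := Bool.toNat_lt b
      simp only [zipApply, hb, if_true]
      refine ⟨rfl, rfl, rfl, by cases b <;> simp, fun k => ?_, fun k => ?_⟩
      · dsimp only
        rw [Function.update_of_ne (by omega), h₅]
      · dsimp only
        rw [Function.update_of_ne (by omega), h₆]
    · rw [instrEquiv_inr]
      have hb : b.toNat < 2 := Bool.toNat_lt b
      have e₁ : (2 + (d.toNat + 2 * b.toNat + 4 * (q' : ℕ)) - 2) / 4 = q' := by
        have := Bool.toNat_lt d; omega
      have e₂ : decide ((2 + (d.toNat + 2 * b.toNat + 4 * (q' : ℕ)) - 2) / 2 % 2 = 1) = b := by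
        have : (2 + (d.toNat + 2 * b.toNat + 4 * (q' : ℕ)) - 2) / 2 % 2 = b.toNat := by
          have := Bool.toNat_lt d; omega
        rw [this]; cases b <;> rfl
      have e₃ : (2 + (d.toNat + 2 * b.toNat + 4 * (q' : ℕ)) - 2) % 2 = d.toNat := by
        have := Bool.toNat_lt d; omega
      simp only [zipApply, e₁, e₂, e₃, Nat.not_lt.2 (Nat.le_add_right 2 _), if_false]
      cases d
      · simp only [Bool.toNat_false, Nat.zero_ne_one, if_false, Bool.false_eq_true]
        refine ⟨rfl, ?_, ?_, ?_, fun k => ?_, fun k => ?_⟩ <;> dsimp only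
        · cases l <;> simp
          · omega
        · simp; omega
        · rw [Function.update_of_ne (by omega)]
          have := h₅ 0
          cases l <;> simpa [sub_eq_add_neg] using this
        · rw [Function.update_of_ne (by omega)]
          have := h₅ (k + 1)
          rw [show pos + -1 - 1 - (k : ℤ) = pos - 1 - ((k + 1 : ℕ) : ℤ) by push_cast; ring, this]
          cases l <;> simp
        · cases k with
          | zero => simp
          | succ k =>
            rw [Function.update_of_ne (by omega),
              show pos + -1 + 1 + ((k + 1 : ℕ) : ℤ) = pos + 1 + (k : ℤ) by push_cast; ring, h₆]
            simp
      · simp only [Bool.toNat_true, if_true]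
        refine ⟨rfl, ?_, ?_, ?_, fun k => ?_, fun k => ?_⟩ <;> dsimp only
        · simp; omega
        · cases r <;> simp
          · omega
        · rw [Function.update_of_ne (by omega)]
          have := h₆ 0
          cases r <;> simpa using this
        · cases k with
          | zero => simp
          | succ k =>
            rw [Function.update_of_ne (by omega),
              show pos + 1 - 1 - ((k + 1 : ℕ) : ℤ) = pos - 1 - (k : ℤ) by push_cast; ring, h₅]
            simp
        · rw [Function.update_of_ne (by omega)]
          have := h₆ (k + 1)
          rw [show pos + 1 + 1 + (k : ℤ) = pos + 1 + ((k + 1 : ℕ) : ℤ) by push_cast; ring, this]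
          cases r <;> simp

theorem describes_cfgAt {n : ℕ} (hn : 0 < n) (M : Machine n) (i : Bool) (t : ℕ) :
    Describes i (cfgAt M i t) ((zipStep n (machineEquiv n M) i)^[t] (zipInit i)) := by
  induction t with
  | zero => exact describes_init hn i
  | succ t ih =>
    rw [cfgAt, Function.iterate_succ_apply', Function.iterate_succ_apply']
    exact ih.step M

theorem Describes.halted_iff {n : ℕ} {i : Bool} {c : Config n} {Z : ZipConfig}
    (h : Describes i c Z) : Halted c ↔ Z.1 = 0 := by
  rw [h.state, Halted]
  cases c.state <;> simp

theorem Describes.outputOf_eq {n : ℕ} {i : Bool} {c : Config n} {Z : ZipConfig}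
    (h : Describes i c Z) : outputOf c = zipOutput Z := by
  obtain ⟨z, l, a, r⟩ := Z
  obtain ⟨-, h₂, h₃, h₄, h₅, h₆⟩ := h
  dsimp only at *
  have hlen : (c.hi - c.lo + 1).toNat = l.length + 1 + r.length := by omega
  have hout : outputOf c =
      (List.range (l.length + 1 + r.length)).map fun j : ℕ => c.tape (c.lo + j) := by
    simp [outputOf, hlen, ← List.map_eq_flatMap, Function.comp_def]
  rw [hout]
  refine List.ext_getElem (by simp [zipOutput, zipOutput]; omega) fun j hj₁ hj₂ => ?_
  have hj : j < l.length + 1 + r.length := by simpa using hj₁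
  simp only [zipOutput, List.getElem_map, List.getElem_range]
  rcases lt_trichotomy j l.length with hlt | heq | hgt
  · rw [List.getElem_append_left (by simpa), List.getElem_reverse,
      show c.lo + (j : ℤ) = c.pos - 1 - ((l.length - 1 - j : ℕ) : ℤ) by omega, h₅,
      List.getD_eq_getElem]
  · subst heq
    rw [h₂]
    simp [h₄]
  · obtain ⟨k, rfl⟩ : ∃ k, j = l.length + 1 + k := ⟨j - (l.length + 1), by omega⟩
    rw [List.getElem_append_right (by simp; omega),
      show c.lo + ((l.length + 1 + k : ℕ) : ℤ) = c.pos + 1 + (k : ℤ) by push_cast; omega, h₆,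
      List.getD_eq_getElem _ _ (by omega)]
    simp [Nat.add_assoc, Nat.add_comm 1 k]

theorem iterate_eq_of_isFixedPt {α : Type*} {f : α → α} {x : α} {t : ℕ}
    (hfix : Function.IsFixedPt f (f^[t] x)) (S : Finset α) (hS : ∀ u ≤ t, f^[u] x ∈ S) {N : ℕ}
    (hN : S.card ≤ N) : f^[N] x = f^[t] x := by
  classical
  have hex : ∃ u, Function.IsFixedPt f (f^[u] x) := ⟨t, hfix⟩
  have hle : Nat.find hex ≤ t := Nat.find_min' hex hfix
  have hstab : ∀ N, Nat.find hex ≤ N → f^[N] x = f^[Nat.find hex] x := fun N hN => by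
    obtain ⟨k, rfl⟩ := Nat.exists_eq_add_of_le' hN
    rw [Function.iterate_add_apply]
    exact (Nat.find_spec hex).iterate k
  have hne : ∀ a b, a < b → b ≤ Nat.find hex → f^[a] x ≠ f^[b] x := fun a b hab hb heq => by
    refine Nat.find_min hex (m := Nat.find hex - b + a) (by omega) ?_
    have h := Nat.find_spec hex
    rwa [show Nat.find hex = Nat.find hex - b + b by omega, Function.iterate_add_apply, ← heq,
      ← Function.iterate_add_apply] at h
  have hcard : (Finset.range (Nat.find hex + 1)).card ≤ S.card := by
    refine Finset.card_le_card_of_injOn (fun u => f^[u] x) (fun u hu => hS u ?_) ?_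
    · have := Finset.mem_range.1 (Finset.mem_coe.1 hu); omega
    · intro a ha b hb heq
      simp only [Finset.coe_range, Set.mem_Iio] at ha hb
      rcases lt_trichotomy a b with h | h | h
      · exact (hne a b h (by omega) heq).elim
      · exact h
      · exact (hne b a h (by omega) heq.symm).elim
  rw [Finset.card_range] at hcard
  rw [hstab N (by omega), hstab t hle]

theorem length_zipOutput_le_zipStep (n m : ℕ) (i : Bool) (Z : ZipConfig) :
    (zipOutput Z).length ≤ (zipOutput (zipStep n m i Z)).length := by
  obtain ⟨z, l, a, r⟩ := Z
  simp only [zipStep, zipApply]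
  split_ifs <;> simp [zipOutput] <;> omega

theorem monotone_length_zipOutput (n m : ℕ) (i : Bool) (Z : ZipConfig) :
    Monotone fun t => (zipOutput ((zipStep n m i)^[t] Z)).length :=
  monotone_nat_of_le_succ fun t => by
    rw [Function.iterate_succ_apply']
    exact length_zipOutput_le_zipStep n m i _

/-- The number of lists of booleans of length at most `L`. -/
noncomputable def numShortLists (L : ℕ) : ℕ := (List.finite_length_le Bool L).toFinset.card

/-- A bound for the halting time of an `n`-state machine with an output of length `L`. -/
noncomputable def timeBound (L n : ℕ) : ℕ := (n + 1) * (numShortLists L * (2 * numShortLists L))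

theorem outputs_iff {n : ℕ} (hn : 0 < n) (M : Machine n) (i : Bool) (s : List Bool) :
    Outputs M i s ↔
      ((zipStep n (machineEquiv n M) i)^[timeBound s.length n] (zipInit i)).1 = 0 ∧
      zipOutput ((zipStep n (machineEquiv n M) i)^[timeBound s.length n] (zipInit i)) = s := by
  constructor
  · rintro ⟨t, ht₁, ht₂⟩
    have hD := describes_cfgAt hn M i
    rw [(hD t).halted_iff] at ht₁
    rw [(hD t).outputOf_eq] at ht₂
    let F := (List.finite_length_le Bool s.length).toFinset
    let S : Finset ZipConfig := Finset.range (n + 1) ×ˢ F ×ˢ Finset.univ ×ˢ F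
    have hcard : S.card = timeBound s.length n := by
      simp [S, F, timeBound, numShortLists]
    have hmem : ∀ u ≤ t, (zipStep n (machineEquiv n M) i)^[u] (zipInit i) ∈ S := fun u hu => by
      have hlen := monotone_length_zipOutput n (machineEquiv n M) i (zipInit i) hu
      dsimp only at hlen
      rw [ht₂] at hlen
      have hstate := (hD u).state
      generalize (zipStep n (machineEquiv n M) i)^[u] (zipInit i) = Z at hlen hstate
      simp only [zipOutput, List.length_append, List.length_reverse, List.length_cons] at hlen
      simp only [S, F, Finset.mem_product, Finset.mem_range, Set.Finite.mem_toFinset,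
        Set.mem_ofPred_eq, Finset.mem_univ, true_and]
      refine ⟨?_, by omega, by omega⟩
      rw [hstate]
      cases (cfgAt M i u).state <;> simp
    rw [iterate_eq_of_isFixedPt (t := t) (by simp [Function.IsFixedPt, zipStep, ht₁]) S hmem
      hcard.le]
    exact ⟨ht₁, ht₂⟩
  · rintro ⟨h₁, h₂⟩
    have hD := describes_cfgAt hn M i (timeBound s.length n)
    exact ⟨_, hD.halted_iff.2 h₁, hD.outputOf_eq.trans h₂⟩

/-- The `n`-state machine with code `m` halts on the blank symbol `i` with output `s`. -/
def CodeOutputs (s : List Bool) (i : Bool) (m n : ℕ) : Prop :=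
  ((zipStep n m i)^[timeBound s.length n] (zipInit i)).1 = 0 ∧
    zipOutput ((zipStep n m i)^[timeBound s.length n] (zipInit i)) = s

noncomputable instance (s : List Bool) (i : Bool) : DecidableRel (CodeOutputs s i) :=
  fun _ _ => inferInstanceAs (Decidable (_ ∧ _))

/-- The number of machine codes counted by `numOutput`. -/
noncomputable def codeCount (s : List Bool) (i : Bool) (n : ℕ) : ℕ :=
  ((List.range ((2 + n * 4) ^ (n * 2))).filter fun m => CodeOutputs s i m n).length

theorem numOutput_eq_codeCount {n : ℕ} (hn : 0 < n) (i : Bool) (s : List Bool) :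
    numOutput n i s = codeCount s i n := by
  have h₁ : numOutput n i s =
      Nat.card {m : Fin ((2 + n * 4) ^ (n * 2)) // CodeOutputs s i m n} :=
    Nat.card_congr ((machineEquiv n).subtypeEquiv fun M => outputs_iff hn M i s)
  rw [h₁, Nat.card_eq_fintype_card, Fintype.card_subtype, codeCount,
    ← List.countP_eq_length_filter, ← Nat.count, Nat.count_eq_card_filter_range,
    ← Nat.Iio_eq_range, ← Fin.map_valEmbedding_univ, Finset.filter_map, Finset.card_map]
  rfl

theorem primrec_zipApply (i : Bool) : Primrec₂ (zipApply i) := by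
  have hc : Primrec fun p : ℕ × ZipConfig => p.1 := .fst
  have hl : Primrec fun p : ℕ × ZipConfig => p.2.2.1 := Primrec.fst.comp (Primrec.snd.comp .snd)
  have hr : Primrec fun p : ℕ × ZipConfig => p.2.2.2.2 :=
    Primrec.snd.comp (Primrec.snd.comp (Primrec.snd.comp .snd))
  have hc' : Primrec fun p : ℕ × ZipConfig => p.1 - 2 := Primrec.nat_sub.comp hc (.const 2)
  have hq : Primrec fun p : ℕ × ZipConfig => (p.1 - 2) / 4 + 1 :=
    Primrec.succ.comp (Primrec.nat_div.comp hc' (.const 4))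
  have hb : Primrec fun p : ℕ × ZipConfig => decide ((p.1 - 2) / 2 % 2 = 1) :=
    (Primrec.eq.comp (Primrec.nat_mod.comp (Primrec.nat_div.comp hc' (.const 2)) (.const 2))
      (.const 1)).decide
  have hhead : Primrec fun l : List Bool => l.headD i :=
    (Primrec.option_getD.comp .list_head? (.const i)).of_eq fun l => by cases l <;> rfl
  refine Primrec.ite (Primrec.nat_lt.comp hc (.const 2))
    (.pair (.const 0) (.pair hl (.pair (Primrec.eq.comp hc (.const 1)).decide hr)))
    (Primrec.ite (Primrec.eq.comp (Primrec.nat_mod.comp hc' (.const 2)) (.const 1))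
      (.pair hq (.pair (Primrec.list_cons.comp hb hl) (.pair (hhead.comp hr)
        (Primrec.list_tail.comp hr))))
      (.pair hq (.pair (Primrec.list_tail.comp hl) (.pair (hhead.comp hl)
        (Primrec.list_cons.comp hb hr)))))

theorem primrec_zipStep (i : Bool) :
    Primrec₂ fun (p : ℕ × ℕ) Z => zipStep p.2 p.1 i Z := by
  have hZ : Primrec fun x : (ℕ × ℕ) × ZipConfig => x.2 := .snd
  have hm : Primrec fun x : (ℕ × ℕ) × ZipConfig => x.1.1 := Primrec.fst.comp .fst
  have hbase : Primrec fun x : (ℕ × ℕ) × ZipConfig => 2 + x.1.2 * 4 :=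
    Primrec.nat_add.comp (.const 2) (Primrec.nat_mul.comp (Primrec.snd.comp .fst) (.const 4))
  have hstate : Primrec fun x : (ℕ × ℕ) × ZipConfig => x.2.1 := Primrec.fst.comp .snd
  have hread : Primrec fun x : (ℕ × ℕ) × ZipConfig => x.2.2.2.1.toNat :=
    (Primrec.dom_finite Bool.toNat).comp
      (Primrec.fst.comp (Primrec.snd.comp (Primrec.snd.comp .snd)))
  have hidx : Primrec fun x : (ℕ × ℕ) × ZipConfig => x.2.2.2.1.toNat + 2 * (x.2.1 - 1) :=
    Primrec.nat_add.comp hread (Primrec.nat_mul.comp (.const 2)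
      (Primrec.nat_sub.comp hstate (.const 1)))
  exact Primrec.ite (Primrec.eq.comp hstate (.const 0)) hZ
    ((primrec_zipApply i).comp (Primrec.nat_mod.comp
      (Primrec.nat_div.comp hm (Primrec.nat_pow.comp hbase hidx)) hbase) hZ)

theorem primrecRel_codeOutputs (s : List Bool) (i : Bool) : PrimrecRel (CodeOutputs s i) := by
  have htime : Primrec fun p : ℕ × ℕ => timeBound s.length p.2 :=
    Primrec.nat_mul.comp (Primrec.succ.comp .snd) (.const _)
  have hrun := Primrec.nat_iterate htime (.const (zipInit i)) (primrec_zipStep i)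
  have hout : Primrec zipOutput :=
    Primrec.list_append.comp (Primrec.list_reverse.comp (Primrec.fst.comp .snd))
      (Primrec.list_cons.comp (Primrec.fst.comp (Primrec.snd.comp .snd))
        (Primrec.snd.comp (Primrec.snd.comp .snd)))
  exact .and (Primrec.eq.comp (Primrec.fst.comp hrun) (.const 0))
    (Primrec.eq.comp (hout.comp hrun) (.const s))

theorem primrec_codeCount (s : List Bool) (i : Bool) : Primrec (codeCount s i) :=
  Primrec.list_length.comp <| (primrecRel_codeOutputs s i).listFilter.comp
    (Primrec.list_range.comp (Primrec.nat_pow.comp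
      (Primrec.nat_add.comp (.const 2) (Primrec.nat_mul.comp .id (.const 4)))
      (Primrec.nat_mul.comp .id (.const 2)))) .id

/-- Numerator and denominator of an unreduced fraction equal to `mApproxQ k s`. -/
noncomputable def approxFraction (s : List Bool) (k : ℕ) : ℕ × ℕ :=
  k.rec (0, 1) fun j p =>
    (p.1 * 2 ^ expo (j + 1) + (codeCount s false (j + 1) + codeCount s true (j + 1)) * p.2,
      p.2 * 2 ^ expo (j + 1))

theorem primrec_approxFraction (s : List Bool) : Primrec (approxFraction s) := by
  have hj : Primrec fun x : ℕ × (ℕ × ℕ) => x.1 + 1 := Primrec.succ.comp .fst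
  have hp₁ : Primrec fun x : ℕ × (ℕ × ℕ) => x.2.1 := Primrec.fst.comp .snd
  have hp₂ : Primrec fun x : ℕ × (ℕ × ℕ) => x.2.2 := Primrec.snd.comp .snd
  have hpow := Primrec.nat_pow.comp (.const 2) (Primrec.expo.comp hj)
  exact Primrec.nat_rec₁ (0, 1) (Primrec.to₂ <| Primrec.pair
    (Primrec.nat_add.comp (Primrec.nat_mul.comp hp₁ hpow) (Primrec.nat_mul.comp
      (Primrec.nat_add.comp ((primrec_codeCount s false).comp hj)
        ((primrec_codeCount s true).comp hj)) hp₂))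
    (Primrec.nat_mul.comp hp₂ hpow))

theorem approxFraction_snd_pos (s : List Bool) (k : ℕ) : 0 < (approxFraction s k).2 := by
  induction k with
  | zero => exact one_pos
  | succ k ih => exact Nat.mul_pos ih (by positivity)

theorem mApproxQ_eq_approxFraction (s : List Bool) (k : ℕ) :
    ((approxFraction s k).1 : ℚ) / ((approxFraction s k).2 : ℚ) = mApproxQ k s := by
  induction k with
  | zero => simp [approxFraction, mApproxQ]
  | succ k ih =>
    have hpos : ((approxFraction s k).2 : ℚ) ≠ 0 := by
      exact_mod_cast (approxFraction_snd_pos s k).ne'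
    rw [mApproxQ, Finset.sum_Icc_succ_top (by omega), ← mApproxQ, ← ih,
      numOutput_eq_codeCount k.succ_pos, numOutput_eq_codeCount k.succ_pos,
      div_add_div _ _ hpos (by positivity)]
    change ((_ * _ + _ * (approxFraction s k).2 : ℕ) : ℚ) / ((_ * _ : ℕ) : ℚ) = _
    push_cast
    rw [mul_comm ((approxFraction s k).2 : ℚ) (_ + _)]
    rfl

/-- Computability of `m`: for every nonempty string `s`, `m(s)` is a computable real: for
every `k ≥ 1`, `0 ≤ m(s) - m_k(s) ≤ 1/2^k`, and there is a computable sequence of rationals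
approximating `m(s)` within `2^(-j)`. -/
theorem mDist_computable_real (s : List Bool) (hs : s ≠ []) :
    (∀ k, 1 ≤ k →
      0 ≤ mDist s - mApprox k s ∧ mDist s - mApprox k s ≤ 1 / 2 ^ k) ∧
    ∃ f : ℕ → ℚ, Computable f ∧ ∀ j, |mDist s - (f j : ℝ)| ≤ 1 / 2 ^ j := by
  refine ⟨fun k _ => mDist_sub_mApprox_mem k s, (mApproxQ · s), ?_, fun j => ?_⟩
  · have h := primrec_approxFraction s
    exact ((Primrec.rat_div (Primrec.fst.comp h) (Primrec.snd.comp h)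
      (approxFraction_snd_pos s)).of_eq (mApproxQ_eq_approxFraction s)).to_comp
  · obtain ⟨h₁, h₂⟩ := mDist_sub_mApprox_mem j s
    rwa [mApproxQ_cast, abs_of_nonneg h₁]
end

section
/- Subunitarity of m: the sum of m(s) over all nonempty binary strings s is strictly smaller than 1. -/
theorem step_of_halted {n : ℕ} (M : Machine n) {c : Config n} (h : Halted c) : step M c = c := by
  unfold Halted at h
  simp [step, h]

theorem cfgAt_eq_of_halted {n : ℕ} {M : Machine n} {i : Bool} {t u : ℕ} (htu : t ≤ u)
    (h : Halted (cfgAt M i t)) : cfgAt M i u = cfgAt M i t := by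
  induction u, htu using Nat.le_induction with
  | base => rfl
  | succ u _ ih =>
    rw [cfgAt, Function.iterate_succ_apply', ← cfgAt, ih, step_of_halted M h]

theorem Outputs.unique {n : ℕ} {M : Machine n} {i : Bool} {s s' : List Bool}
    (h : Outputs M i s) (h' : Outputs M i s') : s = s' := by
  obtain ⟨t, ht, rfl⟩ := h
  obtain ⟨u, hu, rfl⟩ := h'
  rcases le_total t u with htu | hut
  · rw [cfgAt_eq_of_halted htu ht]
  · rw [cfgAt_eq_of_halted hut hu]

theorem card_machine (n : ℕ) : Fintype.card (Machine n) = (4 * n + 2) ^ (2 * n) := by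
  simp only [Fintype.card_fun, Fintype.card_sum, Fintype.card_prod, Fintype.card_bool,
    Fintype.card_fin]
  ring

/-- Distinct strings are output by disjoint sets of machines. -/
theorem sum_numOutput_le (n : ℕ) (i : Bool) (S : Finset (List Bool)) :
    ∑ s ∈ S, numOutput n i s ≤ (4 * n + 2) ^ (2 * n) := by
  classical
  have hcard : ∀ s, numOutput n i s =
      (Finset.univ.filter fun M : Machine n => Outputs M i s).card := fun s => by
    rw [numOutput, Nat.card_eq_fintype_card, Fintype.card_subtype]
  simp only [hcard]
  rw [← card_machine, ← Finset.card_biUnion]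
  · exact Finset.card_le_univ _
  · intro s _ s' _ hne
    refine Finset.disjoint_left.2 fun M hM hM' => hne ?_
    exact (Finset.mem_filter.1 hM).2.unique (Finset.mem_filter.1 hM').2

theorem sum_mTerm_le (n : ℕ) (S : Finset (List Bool)) :
    ∑ s ∈ S, mTerm n s ≤ 2 * ((4 * n + 2 : ℕ) : ℝ) ^ (2 * n) / 2 ^ expo n := by
  simp only [mTerm, ← Finset.sum_div]
  gcongr
  have h := add_le_add (sum_numOutput_le n false S) (sum_numOutput_le n true S)
  rw [← Finset.sum_add_distrib, ← two_mul] at h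
  exact_mod_cast h

theorem machines_div_two_pow_expo_le (n : ℕ) :
    2 * ((4 * n + 2 : ℕ) : ℝ) ^ (2 * n) / 2 ^ expo n ≤ (1 / 2) ^ n := by
  have h : ((4 * n + 2 : ℕ) : ℝ) ^ (2 * n) ≤ 2 ^ Nat.clog 2 ((4 * n + 2) ^ (2 * n)) := by
    exact_mod_cast Nat.le_pow_clog one_lt_two _
  rw [div_le_iff₀ (by positivity), expo, pow_add, pow_succ, one_div, inv_pow]
  field_simp
  linarith

theorem machines_one_div_two_pow_expo_lt :
    2 * ((4 * 1 + 2 : ℕ) : ℝ) ^ (2 * 1) / 2 ^ expo 1 < (1 / 2) ^ 1 := by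
  have h : expo 1 = 8 := by
    norm_num [expo]
  rw [h]
  norm_num

theorem summable_machines_div_two_pow_expo :
    Summable fun j : ℕ =>
      2 * ((4 * (j + 1) + 2 : ℕ) : ℝ) ^ (2 * (j + 1)) / 2 ^ expo (j + 1) :=
  Summable.of_nonneg_of_le (fun _ => by positivity)
    (fun j => machines_div_two_pow_expo_le (j + 1))
    ((summable_nat_add_iff 1).2 summable_geometric_two)

theorem tsum_machines_div_two_pow_expo_lt_one :
    ∑' j : ℕ, 2 * ((4 * (j + 1) + 2 : ℕ) : ℝ) ^ (2 * (j + 1)) / 2 ^ expo (j + 1) < 1 := by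
  have hsum : ∑' j : ℕ, (1 / 2 : ℝ) ^ (j + 1) = 1 := by
    simp only [pow_succ, tsum_mul_right, tsum_geometric_two]
    norm_num
  rw [← hsum]
  exact Summable.tsum_lt_tsum (i := 0) (fun j => machines_div_two_pow_expo_le (j + 1))
    machines_one_div_two_pow_expo_lt summable_machines_div_two_pow_expo
    ((summable_nat_add_iff 1).2 summable_geometric_two)

theorem sum_mDist_le (S : Finset (List Bool)) :
    ∑ s ∈ S, mDist s ≤
      ∑' j : ℕ, 2 * ((4 * (j + 1) + 2 : ℕ) : ℝ) ^ (2 * (j + 1)) / 2 ^ expo (j + 1) := by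
  simp only [mDist]
  rw [← Summable.tsum_finsetSum fun s _ => summable_mTerm s]
  exact Summable.tsum_le_tsum (fun j => sum_mTerm_le (j + 1) S)
    (summable_sum fun s _ => summable_mTerm s) summable_machines_div_two_pow_expo

/-- Subunitarity of `m`: the sum of `m(s)` over all nonempty binary strings `s` is strictly
smaller than `1`. -/
theorem mDist_subunitary :
    ∑' s : {s : List Bool // s ≠ []}, mDist s.val < 1 := by
  refine lt_of_le_of_lt ?_ tsum_machines_div_two_pow_expo_lt_one
  refine Real.tsum_le_of_sum_le (fun s => tsum_nonneg fun j => mTerm_nonneg _ _) fun S => ?_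
  simpa using sum_mDist_le (S.map (Function.Embedding.subtype _))
end

section
/- Exact series for m on the string "0": m("0") = Σ_{n=1}^∞ 2·(4n+2)^(2n−1) / 2^(n+1+⌈log₂((4n+2)^(2n))⌉), where "0" is the one-symbol string consisting of the symbol 0. -/
theorem lo_iterate_step_le {n : ℕ} (M : Machine n) (t : ℕ) (c : Config n) :
    ((step M)^[t] c).lo ≤ c.lo := by
  induction t with
  | zero => exact le_rfl
  | succ t ih =>
    rw [Function.iterate_succ_apply']
    refine le_trans ?_ ih
    simp only [step]
    split
    · exact le_rfl
    · split
      · exact le_rfl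
      · exact min_le_left _ _

theorem le_hi_iterate_step {n : ℕ} (M : Machine n) (t : ℕ) (c : Config n) :
    c.hi ≤ ((step M)^[t] c).hi := by
  induction t with
  | zero => exact le_rfl
  | succ t ih =>
    rw [Function.iterate_succ_apply']
    refine le_trans ih ?_
    simp only [step]
    split
    · exact le_rfl
    · split
      · exact le_rfl
      · exact le_max_left _ _

theorem iterate_step_of_halted {n : ℕ} (M : Machine n) {c : Config n} (hc : Halted c) (t : ℕ) :
    (step M)^[t] c = c := by
  apply Function.iterate_fixed
  unfold Halted at hc
  simp [step, hc]

/-- The output is the single symbol `b` iff the first instruction executed writes `b` and halts. -/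
theorem outputs_singleton_iff {n : ℕ} (M : Machine (n + 1)) (i b : Bool) :
    Outputs M i [b] ↔ M (0, i) = Sum.inl b := by
  have hstep : ∀ b', M (0, i) = Sum.inl b' → ∀ t,
      Halted (cfgAt M i (t + 1)) ∧ outputOf (cfgAt M i (t + 1)) = [b'] := by
    intro b' h t
    have hfirst : step M (initConfig (n + 1) i) =
        { state := none, tape := Function.update (fun _ => i) 0 b', pos := 0, lo := 0, hi := 0 } := by
      simp [step, initConfig, h]
    rw [cfgAt, Function.iterate_succ_apply, hfirst, iterate_step_of_halted M (by rfl)]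
    exact ⟨rfl, by simp [outputOf]⟩
  refine ⟨?_, fun h => ⟨1, hstep b h 0⟩⟩
  rintro ⟨t, hhalt, hout⟩
  cases t with
  | zero => simp [cfgAt, Halted, initConfig] at hhalt
  | succ t =>
    cases h : M (0, i) with
    | inl b' =>
      have := (hstep b' h t).2.symm.trans hout
      simp_all
    | inr x =>
      obtain ⟨q, w, d⟩ := x
      exfalso
      have hlen := congrArg List.length hout
      simp only [outputOf, List.pure_def, List.bind_eq_flatMap, List.length_map,
        List.length_flatMap, List.length_range, List.length_singleton, List.map_const',
        List.sum_replicate, smul_eq_mul, mul_one] at hlen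
      rw [cfgAt, Function.iterate_succ_apply] at hlen
      have hlo := lo_iterate_step_le M t (step M (initConfig (n + 1) i))
      have hhi := le_hi_iterate_step M t (step M (initConfig (n + 1) i))
      have hwidth : (step M (initConfig (n + 1) i)).lo + 1 ≤
          (step M (initConfig (n + 1) i)).hi := by
        cases d <;> simp [step, initConfig, h]
      omega

theorem card_subtype_apply_eq {α β : Type*} [Fintype α] [Fintype β] (a : α) (b : β) :
    Nat.card {f : α → β // f a = b} = Fintype.card β ^ (Fintype.card α - 1) := by
  classical
  have e : {f : α → β // f a = b} ≃ ({j // j ≠ a} → β) :=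
    { toFun := fun f j => f.1 j
      invFun := fun g => ⟨(Equiv.funSplitAt a β).symm (b, g), by simp⟩
      left_inv := by
        rintro ⟨f, rfl⟩
        exact Subtype.ext ((Equiv.funSplitAt a β).symm_apply_apply f)
      right_inv := fun g => by
        ext ⟨j, hj⟩
        simp [hj] }
  rw [Nat.card_congr e, Nat.card_eq_fintype_card, Fintype.card_fun]
  simp [Fintype.card_subtype_compl]

theorem numOutput_singleton (n : ℕ) (i b : Bool) :
    numOutput (n + 1) i [b] = (4 * (n + 1) + 2) ^ (2 * (n + 1) - 1) := by
  simp only [numOutput, outputs_singleton_iff]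
  rw [card_subtype_apply_eq]
  simp only [Fintype.card_sum, Fintype.card_prod, Fintype.card_bool, Fintype.card_fin]
  congr 1 <;> omega

/-- Exact series for `m` on the one-symbol string "0":
`m("0") = Σ_{n=1}^∞ 2·(4n+2)^(2n-1) / 2^(n+1+⌈log₂((4n+2)^(2n))⌉)`. -/
theorem mDist_zero_series :
    mDist [false] =
      ∑' j : ℕ,
        2 * ((4 * (j + 1) + 2 : ℝ)) ^ (2 * (j + 1) - 1) / 2 ^ expo (j + 1) := by
  refine tsum_congr fun j => ?_
  rw [mTerm, numOutput_singleton, numOutput_singleton, ← two_mul]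
  push_cast
  rfl
end
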